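/- arXiv:1305.1327 — 3 statements merged into one kernel-verified Lean document; each statement's English description precedes it below -/
import Mathlib

section
/- Let G = ℤ_{d₁} × ⋯ × ℤ_{d_m} be a finite abelian group, A a finite abelian group with trivial G-action, and let (E₁,π₁), (E₂,π₂) be central extensions of G by A. Suppose f = ∂s for some s ∈ F(G,E₁) and g = ∂u for some u ∈ F(G,E₂). Then f·g⁻¹ ∈ B²(G,A) if and only if f·g⁻¹ ∈ B²_F(G,A). -/
/-- A product of powers of lifts `t i` of the standard generators is a lift of the element whose
coordinates are the exponents. -/
theorem apply_prod_ofFn_pow_val {m : ℕ} {d : Fin m → ℕ} [∀ i, NeZero (d i)] {E : Type*} [Group E]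
    (π : E → ∀ i, ZMod (d i)) (hmul : ∀ e e' : E, π (e * e') = π e + π e')
    (t : Fin m → E) (ht : ∀ i, π (t i) = Pi.single i 1) (x : ∀ i, ZMod (d i)) :
    π (List.ofFn fun i => t i ^ (x i).val).prod = x := by
  let p : E →* Multiplicative (∀ i, ZMod (d i)) :=
    MonoidHom.mk' (fun e => Multiplicative.ofAdd (π e)) fun e e' => by rw [hmul, ofAdd_add]
  have hp (i : Fin m) : p (t i) = Multiplicative.ofAdd (Pi.single i 1) :=
    congrArg Multiplicative.ofAdd (ht i)
  change p _ = Multiplicative.ofAdd x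
  rw [map_list_prod, List.map_ofFn, List.prod_ofFn]
  simp only [Function.comp_apply, map_pow, hp, ← ofAdd_nsmul, ← ofAdd_sum]
  congr 1
  funext j
  rw [Finset.sum_apply, Finset.sum_eq_single j]
  · simp
  · intro i _ hij
    simp [Pi.single_eq_of_ne hij.symm]
  · simp

/-- Two elements of a central extension with the same image differ by an element of the kernel. -/
theorem exists_eq_mul_of_apply_eq {A E G : Type*} [CommGroup A] [Group E] [AddGroup G]
    (ι : A →* E) (π : E → G) (hmul : ∀ e e' : E, π (e * e') = π e + π e')
    (hker : ∀ e : E, π e = 0 ↔ e ∈ ι.range) {e e' : E} (h : π e = π e') :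
    ∃ a : A, e = e' * ι a := by
  have hk : π (e'⁻¹ * e) = 0 := by
    have h' := hmul e' (e'⁻¹ * e)
    rwa [mul_inv_cancel_left, h, left_eq_add] at h'
  obtain ⟨a, ha⟩ := (hker _).1 hk
  exact ⟨a, by rw [ha, mul_inv_cancel_left]⟩

/-- The product of two translates of values of a section, expressed through its factor set. -/
theorem section_mul_section {A E G : Type*} [CommGroup A] [Group E] [Add G]
    (ι : A →* E) (hcent : ∀ a e, Commute (ι a) e) (s : G → E) (f : G → G → A)
    (hf : ∀ x y, ι (f x y) = s x * s y * (s (x + y))⁻¹) (x y : G) (a b : A) :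
    s x * ι a * (s y * ι b) = s (x + y) * ι (f x y * (a * b)) := by
  have h : s x * s y = s (x + y) * ι (f x y) := by
    rw [← (hcent _ _).eq, hf, inv_mul_cancel_right]
  rw [(hcent a (s y * ι b)).right_comm, map_mul, ← mul_assoc (s (x + y)), ← h]
  rw [mul_comm a b, map_mul]
  simp only [mul_assoc]

/-- Central factors can be pulled out of an ordered product of powers. -/
theorem prod_ofFn_mul_pow {A E : Type*} [CommGroup A] [Group E]
    (ι : A →* E) (hcent : ∀ a e, Commute (ι a) e) {m : ℕ} (t : Fin m → E) (b : Fin m → A)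
    (n : Fin m → ℕ) :
    (List.ofFn fun i => (t i * ι (b i)) ^ n i).prod =
      (List.ofFn fun i => t i ^ n i).prod * ι (∏ i, b i ^ n i) := by
  induction m with
  | zero => simp
  | succ m ih =>
    rw [List.ofFn_succ, List.ofFn_succ, List.prod_cons, List.prod_cons, Fin.prod_univ_succ,
      ih (fun i => t i.succ) (fun i => b i.succ) (fun i => n i.succ),
      (hcent (b 0) (t 0)).symm.mul_pow, ← map_pow, map_mul, mul_assoc, mul_assoc]
    congr 1
    rw [← mul_assoc, (hcent _ _).eq, mul_assoc]


/-- Let `G = ℤ_{d₁} × ⋯ × ℤ_{d_m}`, `A` a finite abelian group with trivial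
`G`-action, and `(E₁, π₁)`, `(E₂, π₂)` central extensions of `G` by `A`.  If `f = ∂s` with
`s ∈ F(G,E₁)` and `g = ∂u` with `u ∈ F(G,E₂)` (both valued in `A`), then
`f · g⁻¹ ∈ B²(G,A)` if and only if `f · g⁻¹ ∈ B²_F(G,A)`. -/
theorem coboundary_iff_factored_coboundary
    (m : ℕ) (d : Fin m → ℕ) [∀ i, NeZero (d i)]
    (hdvd : ∀ i j : Fin m, i ≤ j → d i ∣ d j)
    (A : Type) [CommGroup A] [Fintype A]
    (E₁ : Type) [Group E₁] (ι₁ : A →* E₁) (π₁ : E₁ → ∀ i, ZMod (d i))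
    (h₁mul : ∀ e e' : E₁, π₁ (e * e') = π₁ e + π₁ e')
    (h₁surj : Function.Surjective π₁)
    (h₁ker : ∀ e : E₁, π₁ e = 0 ↔ e ∈ ι₁.range)
    (h₁inj : Function.Injective ι₁)
    (h₁cent : ι₁.range ≤ Subgroup.center E₁)
    (E₂ : Type) [Group E₂] (ι₂ : A →* E₂) (π₂ : E₂ → ∀ i, ZMod (d i))
    (h₂mul : ∀ e e' : E₂, π₂ (e * e') = π₂ e + π₂ e')
    (h₂surj : Function.Surjective π₂)
    (h₂ker : ∀ e : E₂, π₂ e = 0 ↔ e ∈ ι₂.range)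
    (h₂inj : Function.Injective ι₂)
    (h₂cent : ι₂.range ≤ Subgroup.center E₂)
    (sv : Fin m → E₁) (hsv : ∀ i : Fin m, π₁ (sv i) = Pi.single i 1)
    (uv : Fin m → E₂) (huv : ∀ i : Fin m, π₂ (uv i) = Pi.single i 1)
    (s : (∀ i, ZMod (d i)) → E₁)
    (hs : ∀ x : ∀ i, ZMod (d i), s x = (List.ofFn fun i => sv i ^ (x i).val).prod)
    (u : (∀ i, ZMod (d i)) → E₂)
    (hu : ∀ x : ∀ i, ZMod (d i), u x = (List.ofFn fun i => uv i ^ (x i).val).prod)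
    (f g : (∀ i, ZMod (d i)) → (∀ i, ZMod (d i)) → A)
    (hf : ∀ x y : ∀ i, ZMod (d i), ι₁ (f x y) = s x * s y * (s (x + y))⁻¹)
    (hg : ∀ x y : ∀ i, ZMod (d i), ι₂ (g x y) = u x * u y * (u (x + y))⁻¹) :
    (∃ v : (∀ i, ZMod (d i)) → A, v 0 = 1 ∧
        ∀ x y : ∀ i, ZMod (d i), f x y * (g x y)⁻¹ = v x * v y * (v (x + y))⁻¹) ↔
    (∃ b : Fin m → A,
        ∀ x y : ∀ i, ZMod (d i), f x y * (g x y)⁻¹ =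
          (∏ i, b i ^ (x i).val) * (∏ i, b i ^ (y i).val) *
            (∏ i, b i ^ ((x + y) i).val)⁻¹) := by
  have hc₁ (a : A) (e : E₁) : Commute (ι₁ a) e :=
    (Subgroup.mem_center_iff.1 (h₁cent ⟨a, rfl⟩) e).symm
  have hc₂ (a : A) (e : E₂) : Commute (ι₂ a) e :=
    (Subgroup.mem_center_iff.1 (h₂cent ⟨a, rfl⟩) e).symm
  have hπs (x) : π₁ (s x) = x := by rw [hs, apply_prod_ofFn_pow_val π₁ h₁mul sv hsv]
  have hπu (x) : π₂ (u x) = x := by rw [hu, apply_prod_ofFn_pow_val π₂ h₂mul uv huv]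
  constructor
  · rintro ⟨v, hv0, hv⟩
    -- The graph of the equivalence of extensions sending `s x` to `u x * ι₂ (v x)`.
    let Γ : Submonoid (E₁ × E₂) :=
      { carrier := {p | ∃ x a, p = (s x * ι₁ a, u x * ι₂ (v x * a))}
        one_mem' := ⟨0, 1, by simp [hs, hu, hv0, Prod.one_eq_mk]⟩
        mul_mem' := by
          rintro _ _ ⟨x, a, rfl⟩ ⟨y, b, rfl⟩
          have hfg : g x y * (v x * a * (v y * b)) = v (x + y) * (f x y * (a * b)) :=
            calc
              _ = v x * v y * g x y * (a * b) := by ac_rfl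
              _ = f x y * v (x + y) * (a * b) := by
                rw [mul_inv_eq_mul_inv_iff_mul_eq_mul.1 (hv x y)]
              _ = _ := by ac_rfl
          exact ⟨x + y, f x y * (a * b), by
            rw [Prod.mk_mul_mk, section_mul_section ι₁ hc₁ s f hf,
              section_mul_section ι₂ hc₂ u g hg, hfg]⟩ }
    have hΓ (i : Fin m) : ∃ b : A, (sv i, uv i * ι₂ b) ∈ Γ := by
      obtain ⟨a, ha⟩ := exists_eq_mul_of_apply_eq ι₁ π₁ h₁mul h₁ker (hπs (π₁ (sv i))).symm
      obtain ⟨c, hc⟩ := exists_eq_mul_of_apply_eq ι₂ π₂ h₂mul h₂ker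
        (((hπu (π₁ (sv i))).trans (hsv i)).trans (huv i).symm)
      refine ⟨c * (v (π₁ (sv i)) * a), π₁ (sv i), a, Prod.ext ha ?_⟩
      change _ = u (π₁ (sv i)) * _
      rw [hc, map_mul ι₂ c, mul_assoc]
    choose b hb using hΓ
    have hvb (x) : v x = ∏ i, b i ^ (x i).val := by
      have hmem : (List.ofFn fun i => (sv i, uv i * ι₂ (b i)) ^ (x i).val).prod ∈ Γ :=
        Γ.list_prod_mem fun p hp => by
          obtain ⟨i, rfl⟩ := (List.mem_ofFn' _ _).1 hp
          exact Γ.pow_mem (hb i) _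
      obtain ⟨y, a, h⟩ := hmem
      have h₁ := congrArg (MonoidHom.fst E₁ E₂) h
      have h₂ := congrArg (MonoidHom.snd E₁ E₂) h
      rw [map_list_prod, List.map_ofFn] at h₁ h₂
      change (List.ofFn fun i => sv i ^ (x i).val).prod = s y * ι₁ a at h₁
      change (List.ofFn fun i => (uv i * ι₂ (b i)) ^ (x i).val).prod = u y * ι₂ (v y * a) at h₂
      rw [← hs] at h₁
      rw [prod_ofFn_mul_pow ι₂ hc₂, ← hu] at h₂
      have hxy : x = y := by
        have h' := congrArg π₁ h₁
        rwa [h₁mul, (h₁ker (ι₁ a)).2 ⟨a, rfl⟩, add_zero, hπs, hπs] at h'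
      subst hxy
      have ha : a = 1 := h₁inj (by rw [map_one]; exact left_eq_mul.1 h₁)
      rw [ha, mul_one] at h₂
      exact (h₂inj (mul_left_cancel h₂)).symm
    exact ⟨b, fun x y => by rw [hv, hvb, hvb, hvb]⟩
  · rintro ⟨b, hb⟩
    exact ⟨fun x => ∏ i, b i ^ (x i).val, by simp, hb⟩
end

section
/- Let G = ℤ_{d₁} × ⋯ × ℤ_{d_m} be a finite abelian group, A a finite abelian group with trivial G-action, and (E,π) a central extension of G by A. Let f = ∂s for some s ∈ F(G,E) with s(x₁,…,x_m) = s₁^{x₁}⋯s_m^{x_m}. Then for all x = (x₁,…,x_m) and y = (y₁,…,y_m) in G, f(x,y) = ∏_{1 ≤ i ≤ m} α_i^{δ_i(x,y)} · ∏_{1 ≤ i < j ≤ m} β_{i,j}^{y_i x_j}, where α_i = s_i^{d_i} ∈ A, β_{i,j} = [s_i, s_j⁻¹] ∈ A (the commutator s_i s_j⁻¹ s_i⁻¹ s_j), and δ_i(x,y) = 1 if x_i + y_i ≥ d_i (as integers) and 0 otherwise. -/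
section CentralProducts

variable {A E : Type*} [CommGroup A] [Group E] {ι : A →* E}

/-- Powers of two elements that commute up to a central factor. -/
theorem pow_mul_pow_of_commute_up_to_central (hc : ∀ a e, ι a * e = e * ι a)
    {u t : E} {c : A} (h : u * t = ι c * (t * u)) (k l : ℕ) :
    u ^ k * t ^ l = ι (c ^ (l * k)) * (t ^ l * u ^ k) := by
  have h₁ : ∀ k : ℕ, u ^ k * t = ι (c ^ k) * (t * u ^ k) := by
    intro k
    induction k with
    | zero => simp
    | succ k ih =>
      calc u ^ (k + 1) * t = u ^ k * (u * t) := by rw [pow_succ, mul_assoc]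
        _ = ι c * (u ^ k * t) * u := by
          rw [h, ← mul_assoc, ← hc, mul_assoc, mul_assoc, mul_assoc]
        _ = ι (c ^ (k + 1)) * (t * u ^ (k + 1)) := by
          rw [ih, pow_succ' c, map_mul, pow_succ u]; simp only [mul_assoc]
  induction l with
  | zero => simp
  | succ l ih =>
    calc u ^ k * t ^ (l + 1) = u ^ k * t ^ l * t := by rw [pow_succ, mul_assoc]
      _ = ι (c ^ (l * k)) * t ^ l * (u ^ k * t) := by rw [ih]; simp only [mul_assoc]
      _ = ι (c ^ (l * k)) * (t ^ l * ι (c ^ k)) * (t * u ^ k) := by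
        rw [h₁]; simp only [mul_assoc]
      _ = ι (c ^ ((l + 1) * k)) * (t ^ (l + 1) * u ^ k) := by
        rw [← hc, add_mul, one_mul, pow_add, map_mul, pow_succ]; simp only [mul_assoc]

/-- Moving an element to the left past an ordered product. -/
theorem prod_ofFn_mul_of_commute_up_to_central (hc : ∀ a e, ι a * e = e * ι a) (t : E) {n : ℕ}
    (u : Fin n → E) (c : Fin n → A) (h : ∀ j, u j * t = ι (c j) * (t * u j)) :
    (List.ofFn u).prod * t = ι (∏ j, c j) * (t * (List.ofFn u).prod) := by
  induction n with
  | zero => simp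
  | succ n ih =>
    have ih' := ih (fun j => u j.succ) (fun j => c j.succ) (fun j => h j.succ)
    rw [List.ofFn_succ, List.prod_cons, Fin.prod_univ_succ, mul_assoc, ih', ← mul_assoc, ← hc,
      mul_comm (c 0), map_mul, mul_assoc, ← mul_assoc (u 0), h 0]
    simp only [mul_assoc]

/-- Central factors can be pulled out of an ordered product. -/
theorem prod_ofFn_central_mul (hc : ∀ a e, ι a * e = e * ι a) {n : ℕ}
    (u : Fin n → E) (c : Fin n → A) :
    (List.ofFn fun j => ι (c j) * u j).prod = ι (∏ j, c j) * (List.ofFn u).prod := by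
  induction n with
  | zero => simp
  | succ n ih =>
    rw [List.ofFn_succ, List.prod_cons, ih (fun j => u j.succ) (fun j => c j.succ),
      List.ofFn_succ, List.prod_cons, Fin.prod_univ_succ, map_mul, mul_assoc,
      ← mul_assoc (u 0), ← hc]
    simp only [mul_assoc]

/-- Multiplying two ordered products of powers of elements that commute up to central factors. -/
theorem prod_ofFn_pow_mul_prod_ofFn_pow (hc : ∀ a e, ι a * e = e * ι a) {n : ℕ}
    (u : Fin n → E) (c : Fin n → Fin n → A)
    (h : ∀ i j, u j * u i = ι (c i j) * (u i * u j)) (a b : Fin n → ℕ) :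
    (List.ofFn fun i => u i ^ a i).prod * (List.ofFn fun i => u i ^ b i).prod =
      ι (∏ i, ∏ j, if i < j then c i j ^ (b i * a j) else 1) *
        (List.ofFn fun i => u i ^ (a i + b i)).prod := by
  induction n with
  | zero => simp
  | succ n ih =>
    have ih' := ih (fun j => u j.succ) (fun i j => c i.succ j.succ)
      (fun i j => h i.succ j.succ) (fun j => a j.succ) (fun j => b j.succ)
    have hmove := prod_ofFn_mul_of_commute_up_to_central hc (u 0 ^ b 0)
      (fun j : Fin n => u j.succ ^ a j.succ) (fun j => c 0 j.succ ^ (b 0 * a j.succ))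
      (fun j => pow_mul_pow_of_commute_up_to_central hc (h 0 j.succ) _ _)
    simp only [List.ofFn_succ, List.prod_cons, Fin.prod_univ_succ, if_false, one_mul,
      Fin.succ_pos, if_true, Fin.not_lt_zero, Fin.succ_lt_succ_iff, map_mul]
    set P := (List.ofFn fun j : Fin n => u j.succ ^ a j.succ).prod
    set Q := (List.ofFn fun j : Fin n => u j.succ ^ b j.succ).prod
    set X := ∏ j : Fin n, c 0 j.succ ^ (b 0 * a j.succ)
    set Y := ∏ i : Fin n, ∏ j : Fin n, if i < j then c i.succ j.succ ^ (b i.succ * a j.succ) else 1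
    set R := (List.ofFn fun j : Fin n => u j.succ ^ (a j.succ + b j.succ)).prod
    calc u 0 ^ a 0 * P * (u 0 ^ b 0 * Q) = u 0 ^ a 0 * (P * u 0 ^ b 0) * Q := by
          simp only [mul_assoc]
      _ = (u 0 ^ a 0 * ι X) * u 0 ^ b 0 * (P * Q) := by rw [hmove]; simp only [mul_assoc]
      _ = ι X * (u 0 ^ (a 0 + b 0) * ι Y) * R := by
          rw [← hc, ih', pow_add]; simp only [mul_assoc]
      _ = ι X * ι Y * (u 0 ^ (a 0 + b 0) * R) := by rw [← hc]; simp only [mul_assoc]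

end CentralProducts

/-- The sum of two residues, as natural numbers, in terms of the residue of the sum. -/
theorem ZMod.val_add_val_eq_ite {n : ℕ} [NeZero n] (x y : ZMod n) :
    x.val + y.val = n * (if n ≤ x.val + y.val then 1 else 0) + (x + y).val := by
  split_ifs with h
  · rw [mul_one, add_comm n, ZMod.val_add_val_of_le h]
  · rw [mul_zero, zero_add, ZMod.val_add_of_lt (not_le.mp h)]


/-- Let `G = ℤ_{d₁} × ⋯ × ℤ_{d_m}`, `A` a finite abelian group, `(E, π)` a
central extension of `G` by `A`, and `f = ∂s` for `s ∈ F(G,E)` with representatives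
`s₁, …, s_m`.  Then `f(x,y) = ∏_{i} αᵢ^{δᵢ(x,y)} · ∏_{i<j} β_{i,j}^{yᵢ xⱼ}` where
`αᵢ = sᵢ^{dᵢ} ∈ A`, `β_{i,j} = [sᵢ, sⱼ⁻¹] ∈ A`, and `δᵢ(x,y) = 1` iff `xᵢ + yᵢ ≥ dᵢ`. -/
theorem factored_cocycle_formula
    (m : ℕ) (d : Fin m → ℕ) [∀ i, NeZero (d i)]
    (hdvd : ∀ i j : Fin m, i ≤ j → d i ∣ d j)
    (A : Type) [CommGroup A] [Fintype A] (E : Type) [Group E]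
    (ι : A →* E) (π : E → ∀ i, ZMod (d i))
    (hπmul : ∀ e e' : E, π (e * e') = π e + π e')
    (hsurj : Function.Surjective π)
    (hker : ∀ e : E, π e = 0 ↔ e ∈ ι.range)
    (hinj : Function.Injective ι)
    (hcent : ι.range ≤ Subgroup.center E)
    (sv : Fin m → E) (hsv : ∀ i : Fin m, π (sv i) = Pi.single i 1)
    (s : (∀ i, ZMod (d i)) → E)
    (hs : ∀ x : ∀ i, ZMod (d i), s x = (List.ofFn fun i => sv i ^ (x i).val).prod)
    (F : (∀ i, ZMod (d i)) → (∀ i, ZMod (d i)) → A)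
    (hF : ∀ x y : ∀ i, ZMod (d i), ι (F x y) = s x * s y * (s (x + y))⁻¹)
    (α : Fin m → A) (hα : ∀ i : Fin m, ι (α i) = sv i ^ d i)
    (β : Fin m → Fin m → A)
    (hβ : ∀ i j : Fin m, ι (β i j) = sv i * (sv j)⁻¹ * (sv i)⁻¹ * ((sv j)⁻¹)⁻¹) :
    ∀ x y : ∀ i, ZMod (d i),
      F x y = (∏ i, α i ^ (if d i ≤ (x i).val + (y i).val then 1 else 0)) *
        ∏ p ∈ Finset.univ.filter (fun p : Fin m × Fin m => p.1 < p.2),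
          β p.1 p.2 ^ ((y p.1).val * (x p.2).val) := by
  intro x y
  have hc : ∀ a e, ι a * e = e * ι a := fun a e =>
    (Subgroup.mem_center_iff.mp (hcent ⟨a, rfl⟩) e).symm
  have hcomm : ∀ i j, sv j * sv i = ι (β i j) * (sv i * sv j) := by
    intro i j
    calc sv j * sv i = sv j * ι (β i j) * ((sv j)⁻¹ * (sv i * sv j)) := by rw [hβ]; group
      _ = ι (β i j) * (sv i * sv j) := by rw [← hc, mul_assoc, mul_inv_cancel_left]
  have hpow : ∀ i, sv i ^ ((x i).val + (y i).val) =
      ι (α i ^ (if d i ≤ (x i).val + (y i).val then 1 else 0)) * sv i ^ ((x + y) i).val := by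
    intro i
    rw [map_pow, hα, ← pow_mul, ← pow_add, Pi.add_apply, ← ZMod.val_add_val_eq_ite]
  apply hinj
  rw [hF, mul_inv_eq_iff_eq_mul, hs, hs, hs, prod_ofFn_pow_mul_prod_ofFn_pow hc sv β hcomm]
  simp only [hpow]
  rw [prod_ofFn_central_mul hc, ← mul_assoc, ← map_mul, mul_comm (∏ i, _), Finset.prod_filter,
    Fintype.prod_prod_type]
end

section
/- Let G = ℤ_{d₁} × ⋯ × ℤ_{d_m} be a finite abelian group, A a finite abelian group with trivial G-action, and let f = ∂s and f′ = ∂s′ where s ∈ F(G,E) and s′ ∈ F(G,E′) for central extensions (E,π), (E′,π′) of G by A, with associated constants α_i = s_i^{d_i}, β_{i,j} = [s_i, s_j⁻¹] for f and α_i′ = (s_i′)^{d_i}, β_{i,j}′ = [s_i′, (s_j′)⁻¹] for f′. Then f·(f′)⁻¹ ∈ B²_F(G,A) if and only if β_{i,j} = β_{i,j}′ for all 1 ≤ i < j ≤ m and, for each 1 ≤ i ≤ m, the element α_i⁻¹·α_i′ ∈ A has a d_i-th root in A (i.e., there exists a ∈ A with a^{d_i} = α_i⁻¹·α_i′). -/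
section FactoredCocycle

variable {A E : Type*} [CommGroup A] [Group E]

/-- Powers of two elements that commute up to a central factor `ι b`. -/
theorem pow_mul_pow_eq_of_mul_eq (ι : A →* E) (hcent : ∀ (a : A) (e : E), ι a * e = e * ι a)
    {g h : E} {b : A} (hgh : h * g = ι b * (g * h)) (n k : ℕ) :
    h ^ n * g ^ k = ι (b ^ (n * k)) * (g ^ k * h ^ n) := by
  have one_pow (n : ℕ) : h ^ n * g = ι (b ^ n) * (g * h ^ n) := by
    induction n with
    | zero => simp
    | succ n ih =>
      calc h ^ (n + 1) * g = h ^ n * (h * g) := by rw [pow_succ, mul_assoc]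
        _ = (h ^ n * ι b) * (g * h) := by rw [hgh, mul_assoc]
        _ = ι b * (h ^ n * g) * h := by rw [← hcent]; simp only [mul_assoc]
        _ = ι (b ^ (n + 1)) * (g * h ^ (n + 1)) := by
          rw [ih, pow_succ' b, map_mul, pow_succ h]; simp only [mul_assoc]
  induction k with
  | zero => simp
  | succ k ih =>
    calc h ^ n * g ^ (k + 1) = (h ^ n * g ^ k) * g := by rw [pow_succ, mul_assoc]
      _ = ι (b ^ (n * k)) * (g ^ k * (h ^ n * g)) := by rw [ih]; simp only [mul_assoc]
      _ = ι (b ^ (n * k)) * ((g ^ k * ι (b ^ n)) * (g * h ^ n)) := by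
        rw [one_pow]; simp only [mul_assoc]
      _ = ι (b ^ (n * (k + 1))) * (g ^ (k + 1) * h ^ n) := by
        rw [← hcent, mul_add, mul_one, pow_add, map_mul, pow_succ g]; simp only [mul_assoc]

/-- Moving a power of `g` to the left past an ordered product of powers. -/
theorem ofFn_prod_mul_pow (ι : A →* E) (hcent : ∀ (a : A) (e : E), ι a * e = e * ι a)
    (g : E) (k : ℕ) {m : ℕ} (h : Fin m → E) (b : Fin m → A)
    (hgh : ∀ j, h j * g = ι (b j) * (g * h j)) (n : Fin m → ℕ) :
    (List.ofFn fun j => h j ^ n j).prod * g ^ k =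
      ι (∏ j, b j ^ (n j * k)) * (g ^ k * (List.ofFn fun j => h j ^ n j).prod) := by
  induction m with
  | zero => simp
  | succ m ih =>
    have ih' := ih (fun j => h j.succ) (fun j => b j.succ) (fun j => hgh j.succ)
      (fun j => n j.succ)
    simp only [List.ofFn_succ, List.prod_cons, Fin.prod_univ_succ]
    set T := (List.ofFn fun j : Fin m => h j.succ ^ n j.succ).prod
    set z := ∏ j : Fin m, b j.succ ^ (n j.succ * k)
    calc h 0 ^ n 0 * T * g ^ k = (h 0 ^ n 0 * ι z) * (g ^ k * T) := by
          rw [mul_assoc, ih', mul_assoc]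
      _ = ι z * (h 0 ^ n 0 * g ^ k) * T := by rw [← hcent]; simp only [mul_assoc]
      _ = ι (b 0 ^ (n 0 * k) * z) * (g ^ k * (h 0 ^ n 0 * T)) := by
          rw [pow_mul_pow_eq_of_mul_eq ι hcent (hgh 0), mul_comm (b 0 ^ _), map_mul]
          simp only [mul_assoc]

/-- Product of two ordered products of powers of elements commuting up to central factors. -/
theorem ofFn_prod_mul_ofFn_prod (ι : A →* E) (hcent : ∀ (a : A) (e : E), ι a * e = e * ι a)
    {m : ℕ} (g : Fin m → E) (β : Fin m → Fin m → A)
    (hβ : ∀ i j, g j * g i = ι (β i j) * (g i * g j)) (n k : Fin m → ℕ) :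
    (List.ofFn fun i => g i ^ n i).prod * (List.ofFn fun i => g i ^ k i).prod =
      ι (∏ i, ∏ j, if i < j then β i j ^ (n j * k i) else 1) *
        (List.ofFn fun i => g i ^ (n i + k i)).prod := by
  induction m with
  | zero => simp
  | succ m ih =>
    have ih' := ih (fun j => g j.succ) (fun i j => β i.succ j.succ)
      (fun i j => hβ i.succ j.succ) (fun j => n j.succ) (fun j => k j.succ)
    have hmove := ofFn_prod_mul_pow ι hcent (g 0) (k 0) (fun j => g j.succ)
      (fun j => β 0 j.succ) (fun j => hβ 0 j.succ) (fun j => n j.succ)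
    simp only [List.ofFn_succ, List.prod_cons, Fin.prod_univ_succ, if_false,
      Fin.succ_pos, if_true, Fin.not_lt_zero, one_mul, Fin.succ_lt_succ_iff]
    set T := (List.ofFn fun i : Fin m => g i.succ ^ n i.succ).prod
    set U := (List.ofFn fun i : Fin m => g i.succ ^ k i.succ).prod
    set V := (List.ofFn fun i : Fin m => g i.succ ^ (n i.succ + k i.succ)).prod
    set z := ∏ j : Fin m, β 0 j.succ ^ (n j.succ * k 0)
    set w := ∏ i : Fin m, ∏ j : Fin m,
      if i < j then β i.succ j.succ ^ (n j.succ * k i.succ) else 1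
    calc g 0 ^ n 0 * T * (g 0 ^ k 0 * U) = g 0 ^ n 0 * (T * g 0 ^ k 0) * U := by
          simp only [mul_assoc]
      _ = (g 0 ^ n 0 * ι z) * (g 0 ^ k 0 * (T * U)) := by rw [hmove]; simp only [mul_assoc]
      _ = ι z * g 0 ^ n 0 * ((g 0 ^ k 0 * ι w) * V) := by rw [← hcent, ih']; simp only [mul_assoc]
      _ = ι z * (g 0 ^ n 0 * ι w) * (g 0 ^ k 0 * V) := by rw [← hcent]; simp only [mul_assoc]
      _ = ι (z * w) * (g 0 ^ (n 0 + k 0) * V) := by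
          rw [← hcent, map_mul, pow_add]; simp only [mul_assoc]

/-- Extracting the central factors `g i ^ d i` from an ordered product of powers. -/
theorem ofFn_prod_pow_add_mul (ι : A →* E) (hcent : ∀ (a : A) (e : E), ι a * e = e * ι a)
    {m : ℕ} (d : Fin m → ℕ) (g : Fin m → E) (α : Fin m → A)
    (hα : ∀ i, ι (α i) = g i ^ d i) (r c : Fin m → ℕ) :
    (List.ofFn fun i => g i ^ (r i + d i * c i)).prod =
      ι (∏ i, α i ^ c i) * (List.ofFn fun i => g i ^ r i).prod := by
  induction m with
  | zero => simp
  | succ m ih =>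
    have ih' := ih (fun j => d j.succ) (fun j => g j.succ) (fun j => α j.succ)
      (fun j => hα j.succ) (fun j => r j.succ) (fun j => c j.succ)
    simp only [List.ofFn_succ, List.prod_cons, Fin.prod_univ_succ]
    rw [ih', pow_add, pow_mul, ← hα, ← map_pow, ← hcent, map_mul, mul_assoc, mul_assoc,
      ← mul_assoc (g 0 ^ r 0), ← hcent]
    simp only [mul_assoc]

theorem ZMod.val_add_add_mul_div {n : ℕ} [NeZero n] (a b : ZMod n) :
    (a + b).val + n * ((a.val + b.val) / n) = a.val + b.val := by
  rw [ZMod.val_add, Nat.mod_add_div]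

/-- The cocycle of a factored section in terms of the constants `α` and `β`. -/
theorem factored_cocycle_eq {m : ℕ} {d : Fin m → ℕ} [∀ i, NeZero (d i)]
    (ι : A →* E) (hinj : Function.Injective ι) (hcent : ι.range ≤ Subgroup.center E)
    {g : Fin m → E} {s : (∀ i, ZMod (d i)) → E}
    (hs : ∀ x : ∀ i, ZMod (d i), s x = (List.ofFn fun i => g i ^ (x i).val).prod)
    {f : (∀ i, ZMod (d i)) → (∀ i, ZMod (d i)) → A}
    (hf : ∀ x y : ∀ i, ZMod (d i), ι (f x y) = s x * s y * (s (x + y))⁻¹)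
    {α : Fin m → A} (hα : ∀ i : Fin m, ι (α i) = g i ^ d i)
    {β : Fin m → Fin m → A}
    (hβ : ∀ i j : Fin m, ι (β i j) = g i * (g j)⁻¹ * (g i)⁻¹ * ((g j)⁻¹)⁻¹)
    (x y : ∀ i, ZMod (d i)) :
    f x y = (∏ i, ∏ j, if i < j then β i j ^ ((x j).val * (y i).val) else 1) *
      ∏ i, α i ^ (((x i).val + (y i).val) / d i) := by
  have hc (a : A) (e : E) : ι a * e = e * ι a :=
    ((Subgroup.mem_center_iff.1 (hcent ⟨a, rfl⟩)) e).symm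
  have hβ' (i j : Fin m) : g j * g i = ι (β i j) * (g i * g j) := by
    have h : ι (β i j) * (g j)⁻¹ = g i * (g j)⁻¹ * (g i)⁻¹ := by rw [hβ]; group
    rw [hc] at h
    have h' : ι (β i j) = g j * (g i * (g j)⁻¹ * (g i)⁻¹) := by rw [← h]; group
    rw [h']; group
  apply hinj
  rw [hf, hs x, hs y, ofFn_prod_mul_ofFn_prod ι hc g β hβ']
  have hcarry := ofFn_prod_pow_add_mul ι hc d g α hα (fun i => ((x + y) i).val)
    (fun i => ((x i).val + (y i).val) / d i)
  simp only [Pi.add_apply, ZMod.val_add_add_mul_div] at hcarry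
  rw [hcarry, hs (x + y), map_mul]
  simp only [Pi.add_apply, mul_assoc, mul_inv_cancel, mul_one]

theorem factored_coboundary_eq {m : ℕ} {d : Fin m → ℕ} [∀ i, NeZero (d i)]
    (b : Fin m → A) (x y : ∀ i, ZMod (d i)) :
    (∏ i, b i ^ (x i).val) * (∏ i, b i ^ (y i).val) * (∏ i, b i ^ ((x + y) i).val)⁻¹ =
      ∏ i, (b i ^ d i) ^ (((x i).val + (y i).val) / d i) := by
  rw [mul_inv_eq_iff_eq_mul, ← Finset.prod_mul_distrib, ← Finset.prod_mul_distrib]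
  refine Finset.prod_congr rfl fun i _ => ?_
  rw [← pow_add, ← pow_mul, ← pow_add, Pi.add_apply, add_comm (d i * _),
    ZMod.val_add_add_mul_div]

/-- A lift of a generator of a trivial factor is central, so its commutators are trivial. -/
theorem commutator_eq_one_of_eq_one {m : ℕ} {d : Fin m → ℕ}
    (ι : A →* E) (π : E → ∀ i, ZMod (d i))
    (hker : ∀ e : E, π e = 0 ↔ e ∈ ι.range) (hinj : Function.Injective ι)
    (hcent : ι.range ≤ Subgroup.center E)
    {g : Fin m → E} (hg : ∀ i : Fin m, π (g i) = Pi.single i 1)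
    {β : Fin m → Fin m → A}
    (hβ : ∀ i j : Fin m, ι (β i j) = g i * (g j)⁻¹ * (g i)⁻¹ * ((g j)⁻¹)⁻¹)
    {i j : Fin m} (h : d i = 1 ∨ d j = 1) : β i j = 1 := by
  have hz {k : Fin m} (hk : d k = 1) : g k ∈ Subgroup.center E := by
    have : Subsingleton (ZMod (d k)) := by rw [hk]; infer_instance
    refine hcent ((hker _).1 ?_)
    rw [hg, Subsingleton.elim (1 : ZMod (d k)) 0, Pi.single_zero]
  have hcomm : Commute (g i) (g j) := by
    rcases h with h | h
    · exact (Subgroup.mem_center_iff.1 (hz h) (g j)).symm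
    · exact Subgroup.mem_center_iff.1 (hz h) (g i)
  apply hinj
  rw [hβ, map_one, hcomm.inv_right.eq, mul_inv_cancel_right, mul_inv_cancel]

theorem ZMod.val_single {m : ℕ} {d : Fin m → ℕ} (i k : Fin m) (a : ZMod (d i)) :
    ((Pi.single i a : ∀ i, ZMod (d i)) k).val = if k = i then a.val else 0 := by
  split_ifs with h
  · subst h; simp
  · simp [h]

end FactoredCocycle


/-- Let `G = ℤ_{d₁} × ⋯ × ℤ_{d_m}`, `A` a finite abelian group, and let
`f = ∂s`, `f′ = ∂s′` for `s ∈ F(G,E)`, `s′ ∈ F(G,E′)` with central extensions `(E,π)`,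
`(E′,π′)` of `G` by `A`.  With `αᵢ = sᵢ^{dᵢ}`, `β_{i,j} = [sᵢ, sⱼ⁻¹]` (and primed versions
for `s′`), one has `f · (f′)⁻¹ ∈ B²_F(G,A)` iff `β_{i,j} = β′_{i,j}` for all `i < j`
and each `αᵢ⁻¹ · α′ᵢ` has a `dᵢ`-th root in `A`. -/
theorem factored_coboundary_criterion
    (m : ℕ) (d : Fin m → ℕ) [∀ i, NeZero (d i)]
    (hdvd : ∀ i j : Fin m, i ≤ j → d i ∣ d j)
    (A : Type) [CommGroup A] [Fintype A]
    (E : Type) [Group E] (ι : A →* E) (π : E → ∀ i, ZMod (d i))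
    (hmul : ∀ e e' : E, π (e * e') = π e + π e')
    (hsurj : Function.Surjective π)
    (hker : ∀ e : E, π e = 0 ↔ e ∈ ι.range)
    (hinj : Function.Injective ι)
    (hcent : ι.range ≤ Subgroup.center E)
    (E' : Type) [Group E'] (ι' : A →* E') (π' : E' → ∀ i, ZMod (d i))
    (hmul' : ∀ e e' : E', π' (e * e') = π' e + π' e')
    (hsurj' : Function.Surjective π')
    (hker' : ∀ e : E', π' e = 0 ↔ e ∈ ι'.range)
    (hinj' : Function.Injective ι')
    (hcent' : ι'.range ≤ Subgroup.center E')
    (sv : Fin m → E) (hsv : ∀ i : Fin m, π (sv i) = Pi.single i 1)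
    (sv' : Fin m → E') (hsv' : ∀ i : Fin m, π' (sv' i) = Pi.single i 1)
    (s : (∀ i, ZMod (d i)) → E)
    (hs : ∀ x : ∀ i, ZMod (d i), s x = (List.ofFn fun i => sv i ^ (x i).val).prod)
    (s' : (∀ i, ZMod (d i)) → E')
    (hs' : ∀ x : ∀ i, ZMod (d i), s' x = (List.ofFn fun i => sv' i ^ (x i).val).prod)
    (f f' : (∀ i, ZMod (d i)) → (∀ i, ZMod (d i)) → A)
    (hf : ∀ x y : ∀ i, ZMod (d i), ι (f x y) = s x * s y * (s (x + y))⁻¹)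
    (hf' : ∀ x y : ∀ i, ZMod (d i), ι' (f' x y) = s' x * s' y * (s' (x + y))⁻¹)
    (α : Fin m → A) (hα : ∀ i : Fin m, ι (α i) = sv i ^ d i)
    (α' : Fin m → A) (hα' : ∀ i : Fin m, ι' (α' i) = sv' i ^ d i)
    (β : Fin m → Fin m → A)
    (hβ : ∀ i j : Fin m, ι (β i j) = sv i * (sv j)⁻¹ * (sv i)⁻¹ * ((sv j)⁻¹)⁻¹)
    (β' : Fin m → Fin m → A)
    (hβ' : ∀ i j : Fin m, ι' (β' i j) = sv' i * (sv' j)⁻¹ * (sv' i)⁻¹ * ((sv' j)⁻¹)⁻¹) :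
    (∃ b : Fin m → A,
        ∀ x y : ∀ i, ZMod (d i), f x y * (f' x y)⁻¹ =
          (∏ i, b i ^ (x i).val) * (∏ i, b i ^ (y i).val) *
            (∏ i, b i ^ ((x + y) i).val)⁻¹) ↔
    ((∀ i j : Fin m, i < j → β i j = β' i j) ∧
      ∀ i : Fin m, ∃ a : A, a ^ d i = (α i)⁻¹ * α' i) := by
  have F := factored_cocycle_eq ι hinj hcent hs hf hα hβ
  have F' := factored_cocycle_eq ι' hinj' hcent' hs' hf' hα' hβ'
  simp only [factored_coboundary_eq]
  constructor
  · rintro ⟨b, hb⟩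
    have hval (i : Fin m) (hi : 1 < d i) : (1 : ZMod (d i)).val = 1 :=
      have : Fact (1 < d i) := ⟨hi⟩
      ZMod.val_one (d i)
    have hd (i : Fin m) : d i = 1 ∨ 1 < d i := by
      have := Nat.pos_of_ne_zero (NeZero.ne (d i))
      omega
    constructor
    · intro i j hij
      rcases hd i with hi | hi
      · rw [commutator_eq_one_of_eq_one ι π hker hinj hcent hsv hβ (.inl hi),
          commutator_eq_one_of_eq_one ι' π' hker' hinj' hcent' hsv' hβ' (.inl hi)]
      rcases hd j with hj | hj
      · rw [commutator_eq_one_of_eq_one ι π hker hinj hcent hsv hβ (.inr hj),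
          commutator_eq_one_of_eq_one ι' π' hker' hinj' hcent' hsv' hβ' (.inr hj)]
      have hcarry (k : Fin m) : (((Pi.single j 1 : ∀ i, ZMod (d i)) k).val +
          ((Pi.single i 1 : ∀ i, ZMod (d i)) k).val) / d k = 0 := by
        simp only [ZMod.val_single, hval _ hi, hval _ hj]
        apply Nat.div_eq_of_lt
        have := Nat.pos_of_ne_zero (NeZero.ne (d k))
        by_cases hki : k = i
        · subst hki; simpa [hij.ne] using hi
        · by_cases hkj : k = j
          · subst hkj; simpa [hki] using hj
          · simpa [hki, hkj] using this
      have hprod (γ : Fin m → Fin m → A) : (∏ k, ∏ l, if k < l then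
          γ k l ^ (((Pi.single j 1 : ∀ i, ZMod (d i)) l).val *
            ((Pi.single i 1 : ∀ i, ZMod (d i)) k).val) else 1) = γ i j := by
        simp only [ZMod.val_single, hval _ hi, hval _ hj]
        rw [Finset.prod_eq_single i, Finset.prod_eq_single j]
        · simp [hij]
        · intro l _ hl; simp [hl]
        · simp
        · intro k _ hk; simp [hk]
        · simp
      have h := hb (Pi.single j 1) (Pi.single i 1)
      simp only [F, F', hcarry, hprod, pow_zero, Finset.prod_const_one, mul_one] at h
      exact mul_inv_eq_one.1 h
    · intro i
      rcases hd i with hi | hi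
      · exact ⟨(α i)⁻¹ * α' i, by rw [hi, pow_one]⟩
      have hpred : ((d i - 1 : ℕ) : ZMod (d i)).val = d i - 1 :=
        ZMod.val_cast_of_lt (by omega)
      have hcarry (γ : Fin m → A) : (∏ k, γ k ^
          ((((Pi.single i ((d i - 1 : ℕ) : ZMod (d i)) : ∀ i, ZMod (d i)) k).val +
          ((Pi.single i 1 : ∀ i, ZMod (d i)) k).val) / d k)) = γ i := by
        simp only [ZMod.val_single, hval _ hi, hpred]
        rw [Finset.prod_eq_single i]
        · simp [Nat.sub_add_cancel hi.le, Nat.div_self (Nat.zero_lt_of_lt hi)]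
        · intro k _ hk; simp [hk]
        · simp
      have hprod (γ : Fin m → Fin m → A) : (∏ k, ∏ l, if k < l then
          γ k l ^ (((Pi.single i ((d i - 1 : ℕ) : ZMod (d i)) : ∀ i, ZMod (d i)) l).val *
            ((Pi.single i 1 : ∀ i, ZMod (d i)) k).val) else 1) = 1 := by
        refine Finset.prod_eq_one fun k _ => Finset.prod_eq_one fun l _ => ?_
        split_ifs with hkl
        · simp only [ZMod.val_single]
          by_cases hk : k = i
          · have hl : l ≠ i := fun hl => hkl.ne (hk.trans hl.symm)
            simp [hl]
          · simp [hk]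
        · rfl
      have h := hb (Pi.single i ((d i - 1 : ℕ) : ZMod (d i))) (Pi.single i 1)
      rw [F, F', hprod, hprod, hcarry, hcarry, hcarry fun k => b k ^ d k, one_mul, one_mul] at h
      exact ⟨(b i)⁻¹, by rw [inv_pow, ← h, mul_inv, inv_inv]⟩
  · rintro ⟨hββ, hroot⟩
    choose a ha using hroot
    refine ⟨fun i => (a i)⁻¹, fun x y => ?_⟩
    have hprod : (∏ i, ∏ j, if i < j then β i j ^ ((x j).val * (y i).val) else 1) =
        ∏ i, ∏ j, if i < j then β' i j ^ ((x j).val * (y i).val) else 1 := by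
      refine Finset.prod_congr rfl fun i _ => Finset.prod_congr rfl fun j _ => ?_
      split_ifs with hij
      · rw [hββ i j hij]
      · rfl
    rw [F, F', hprod, mul_inv, mul_mul_mul_comm, mul_inv_cancel, one_mul, ← Finset.prod_inv_distrib,
      ← Finset.prod_mul_distrib]
    refine Finset.prod_congr rfl fun i _ => ?_
    rw [inv_pow, ha, mul_inv, inv_inv, mul_pow, inv_pow]
end
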